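/- arXiv:1207.2368 — 3 statements merged into one kernel-verified Lean document; each statement's English description precedes it below -/
import Mathlib

section
/- For all integers n and d with 1 ≤ d ≤ n, T(2n,d) = C(2d-2, d-1) · t(2n) / (2^{2d-2} d) − Σ_{j=1}^{⌊(d-1)/2⌋} C(2d-2j-2, d-1) · t(2j) · t(2n-2j) / (2^{2d-3} (2^{2j}-1) B_{2j} d), where C(a,b) denotes the binomial coefficient, t(2m) = Σ_{k≥1} 1/(2k-1)^{2m}, and B_{2j} are the Bernoulli numbers. -/
open scoped BigOperators

/-- Depth-one multiple t-value: `t1 m = t(2m) = ∑_{k ≥ 1} 1/(2k-1)^{2m}`. -/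
noncomputable def t1 (m : ℕ) : ℝ := ∑' k : ℕ, 1 / (2 * (k : ℝ) + 1) ^ (2 * m)

/-- Multiple t-value `t(s₀, …, s_{d-1})`, summed over `n₀ > n₁ > ⋯ > n_{d-1} ≥ 1`
(encoded via `f i = n_i - 1`, so the odd number `2 n_i - 1` is `2 (f i) + 1`). -/
noncomputable def mtv (d : ℕ) (s : Fin d → ℕ) : ℝ :=
  ∑' f : {f : Fin d → ℕ // StrictAnti f}, ∏ i, 1 / (2 * (f.1 i : ℝ) + 1) ^ (s i)

/-- `Tsum n d = T(2n, d)`: the sum of all multiple t-values of weight `2n` and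
depth `d` with all arguments even. -/
noncomputable def Tsum (n d : ℕ) : ℝ :=
  ∑ j ∈ (Finset.Nat.antidiagonalTuple d n).filter (fun j => ∀ i, 1 ≤ j i),
    mtv d (fun i => 2 * j i)

open Finset Filter Topology

section
variable {R : Type*} [CommRing R]

theorem coeff_prod_one_add_C_mul_X {ι : Type*} (S : Finset ι) (b : ι → R) (d : ℕ) :
    (∏ k ∈ S, (1 + Polynomial.C (b k) * Polynomial.X)).coeff d
      = ∑ s ∈ S.powersetCard d, ∏ k ∈ s, b k := by
  simp only [prod_one_add, prod_mul_distrib, prod_const, ← map_prod, Polynomial.finsetSum_coeff,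
    Polynomial.coeff_C_mul_X_pow]
  rw [powersetCard_eq_filter, sum_filter]
  exact sum_congr rfl fun s _ => by simp only [eq_comm]

/-- The power series `a X + a² X² + ⋯`. -/
noncomputable def geomTail (a : R) : PowerSeries R := PowerSeries.mk fun j => if j = 0 then 0 else a ^ j

theorem one_sub_mul_geomTail (a : R) :
    (1 - PowerSeries.C a * PowerSeries.X) * geomTail a = PowerSeries.C a * PowerSeries.X := by
  ext n
  rw [sub_mul, one_mul, mul_assoc]
  rcases n with _ | _ | n <;> simp [geomTail, PowerSeries.coeff_X, PowerSeries.coeff_succ_X_mul, pow_succ']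

theorem coeff_one_sub_X_pow (n d : ℕ) :
    ((1 - Polynomial.X : Polynomial R) ^ n).coeff d = (-1) ^ d * n.choose d := by
  have h := coeff_prod_one_add_C_mul_X (range n) (fun _ => (-1 : R)) d
  simp only [prod_const, card_range, map_neg, map_one, neg_one_mul, ← sub_eq_add_neg] at h
  rw [h, sum_congr rfl fun s hs => by rw [(mem_powersetCard.1 hs).2], sum_const, card_powersetCard,
    card_range, nsmul_eq_mul, mul_comm]

theorem prod_mul_sum_powersetCard {ι : Type*} (S : Finset ι) (a : ι → R) (d : ℕ) :
    (∏ k ∈ S, (1 - PowerSeries.C (a k) * PowerSeries.X)) *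
        ∑ s ∈ S.powersetCard d, ∏ k ∈ s, geomTail (a k)
      = PowerSeries.mk fun n => (-1) ^ (n + d) * n.choose d * ∑ s ∈ S.powersetCard n, ∏ k ∈ s, a k := by
  rw [← coeff_prod_one_add_C_mul_X, ← Polynomial.coeff_C_mul, map_prod, ← prod_mul_distrib]
  have h : ∀ k ∈ S, Polynomial.C (1 - PowerSeries.C (a k) * PowerSeries.X) *
      (1 + Polynomial.C (geomTail (a k)) * Polynomial.X) =
      1 + Polynomial.C (PowerSeries.C (a k)) * (Polynomial.C (- PowerSeries.X) * (1 - Polynomial.X)) := by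
    intro k _
    rw [mul_add, ← mul_assoc, ← Polynomial.C_mul, one_sub_mul_geomTail]
    simp only [map_sub, map_mul, map_neg, map_one]
    ring
  rw [prod_congr rfl h]
  ext n
  simp only [prod_one_add, prod_mul_distrib, prod_const, ← map_prod, Polynomial.finsetSum_coeff,
    ← map_pow, Polynomial.coeff_C_mul, coeff_one_sub_X_pow, map_sum, PowerSeries.coeff_mk, PowerSeries.coeff_C_mul]
  rw [powersetCard_eq_filter, sum_filter, mul_sum]
  refine sum_congr rfl fun s _ => ?_
  have e : ((-PowerSeries.X) ^ #s * ((-1) ^ d * (((#s).choose d : ℕ) : PowerSeries R))) =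
    PowerSeries.C ((-1) ^ (#s + d) * ((#s).choose d : R)) * PowerSeries.X ^ #s := by
    rw [neg_pow]; simp only [map_mul, map_pow, map_neg, map_one, map_natCast]; ring
  rw [e, PowerSeries.coeff_C_mul, PowerSeries.coeff_X_pow]
  by_cases hs : #s = n
  · subst hs; simp; ring
  · simp [hs, Ne.symm hs]
end

/-- The squared reciprocals `1 / (2k + 1)²` of the odd numbers. -/
noncomputable def oddInvSq (k : ℕ) : ℝ := 1 / (2 * (k : ℝ) + 1) ^ 2

theorem oddInvSq_nonneg (k : ℕ) : 0 ≤ oddInvSq k := by unfold oddInvSq; positivity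

theorem oddInvSq_le_one (k : ℕ) : oddInvSq k ≤ 1 := by
  unfold oddInvSq
  rw [div_le_one (by positivity)]
  exact one_le_pow₀ (by linarith [(k.cast_nonneg : (0 : ℝ) ≤ k)])

theorem summable_oddInvSq : Summable oddInvSq := by
  have h := (Real.summable_one_div_nat_pow (p := 2)).2 one_lt_two
  have h2 := h.comp_injective (i := fun k : ℕ => 2 * k + 1) (fun a b h => by simpa using h)
  refine h2.congr fun k => ?_
  simp [oddInvSq]

/-- Strictly decreasing `d`-tuples of naturals correspond to `d`-element sets. -/
noncomputable def strictAntiEquiv (d : ℕ) : {f : Fin d → ℕ // StrictAnti f} ≃ {s : Finset ℕ // #s = d} :=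
  Equiv.ofBijective
    (fun f => ⟨univ.image f.1, by simp [card_image_of_injective _ f.2.injective]⟩) <| by
    constructor
    · intro f g h
      have h' : Set.range f.1 = Set.range g.1 := by
        have := congrArg (fun s : {s : Finset ℕ // #s = d} => (s.1 : Set ℕ)) h
        simpa using this
      have h2 : f.1 ∘ Fin.rev = g.1 ∘ Fin.rev := by
        refine (StrictMono.range_inj (f.2.comp Fin.rev_strictAnti) (g.2.comp Fin.rev_strictAnti)).1 ?_
        rw [Fin.rev_surjective.range_comp, Fin.rev_surjective.range_comp, h']
      exact Subtype.ext (Fin.rev_surjective.injective_comp_right h2)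
    · rintro ⟨s, hs⟩
      refine ⟨⟨s.orderEmbOfFin hs ∘ Fin.rev,
        (s.orderEmbOfFin hs).strictMono.comp_strictAnti Fin.rev_strictAnti⟩, Subtype.ext ?_⟩
      rw [← coe_inj]
      rw [coe_image, coe_univ, Set.image_univ, Fin.rev_surjective.range_comp, range_orderEmbOfFin]

theorem prod_strictAntiEquiv {M : Type*} [CommMonoid M] {d : ℕ} (f : {f : Fin d → ℕ // StrictAnti f}) (g : ℕ → M) :
    ∏ k ∈ (strictAntiEquiv d f).1, g k = ∏ i, g (f.1 i) :=
  prod_image fun _ _ _ _ h => f.2.injective h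

theorem coeff_prod_univ_fin {R : Type*} [CommRing R] {d : ℕ} (g : Fin d → PowerSeries R) (n : ℕ) :
    PowerSeries.coeff n (∏ i, g i)
      = ∑ j ∈ Finset.Nat.antidiagonalTuple d n, ∏ i, PowerSeries.coeff (j i) (g i) := by
  rw [PowerSeries.coeff_prod, ← piAntidiag_univ_fin_eq_antidiagonalTuple]
  refine sum_bij' (fun l _ => ⇑l) (fun j _ => Finsupp.equivFunOnFinite.symm j) ?_ ?_ ?_ ?_ ?_ <;>
    simp [mem_finsuppAntidiag]

theorem hasSum_coeff_prod_geomTail (n d : ℕ) :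
    HasSum (fun f : {f : Fin d → ℕ // StrictAnti f} =>
      PowerSeries.coeff n (∏ i, geomTail (oddInvSq (f.1 i)))) (Tsum n d) := by
  have hs : Summable fun f : {f : Fin d → ℕ // StrictAnti f} => ∏ i, oddInvSq (f.1 i) := by
    have h := summable_finsetProd_of_summable_nonneg oddInvSq_nonneg summable_oddInvSq
    have h1 := h.comp_injective (Subtype.val_injective (p := fun s : Finset ℕ => #s = d))
    refine ((strictAntiEquiv d).summable_iff.2 h1).congr fun f => ?_
    exact prod_strictAntiEquiv f _
  simp only [coeff_prod_univ_fin]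
  rw [Tsum, sum_filter]
  refine hasSum_sum fun j _ => ?_
  split_ifs with hj
  · have e : ∀ f : {f : Fin d → ℕ // StrictAnti f},
        ∏ i, PowerSeries.coeff (j i) (geomTail (oddInvSq (f.1 i)))
          = ∏ i, 1 / (2 * (f.1 i : ℝ) + 1) ^ (2 * j i) := by
      refine fun f => prod_congr rfl fun i _ => ?_
      rw [geomTail, PowerSeries.coeff_mk, if_neg (by have := hj i; omega), oddInvSq, div_pow, one_pow, ← pow_mul]
    simp only [← e, mtv]
    refine (Summable.of_nonneg_of_le (fun f => ?_) (fun f => ?_) hs).hasSum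
    · rw [e]; positivity
    · refine prod_le_prod (fun i _ => ?_) (fun i _ => ?_) <;>
        rw [geomTail, PowerSeries.coeff_mk, if_neg (by have := hj i; omega)]
      · exact pow_nonneg (oddInvSq_nonneg _) _
      · exact pow_le_of_le_one (oddInvSq_nonneg _) (oddInvSq_le_one _) (by have := hj i; omega)
  · push Not at hj
    obtain ⟨i, hi⟩ := hj
    convert! hasSum_zero using 2 with f
    exact prod_eq_zero (mem_univ i) (by simp [geomTail, Nat.lt_one_iff.1 hi])

theorem tendsto_sum_powersetCard {g : Finset ℕ → ℝ} {d : ℕ} {T : ℝ}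
    (h : HasSum (fun s : {s : Finset ℕ // #s = d} => g s.1) T) :
    Tendsto (fun N => ∑ s ∈ (range N).powersetCard d, g s) atTop (𝓝 T) := by
  have h1 := (hasSum_subtype_iff_indicator (s := {s : Finset ℕ | #s = d})).1 h
  refine ((h1.comp tendsto_finset_powerset_atTop_atTop).comp tendsto_finset_range).congr fun N => ?_
  simp [powersetCard_eq_filter, sum_filter, Set.indicator_apply]

theorem tendsto_coeff_sum_powersetCard (n d : ℕ) :
    Tendsto (fun N => PowerSeries.coeff n
      (∑ s ∈ (range N).powersetCard d, ∏ k ∈ s, geomTail (oddInvSq k))) atTop (𝓝 (Tsum n d)) := by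
  simp only [map_sum]
  refine tendsto_sum_powersetCard (g := fun s => PowerSeries.coeff n (∏ k ∈ s, geomTail (oddInvSq k))) ?_
  rw [← (strictAntiEquiv d).hasSum_iff]
  refine (hasSum_coeff_prod_geomTail n d).congr_fun fun f => ?_
  simp [prod_strictAntiEquiv]

theorem prod_range_two_mul {M : Type*} [CommMonoid M] (f : ℕ → M) (n : ℕ) :
    ∏ k ∈ range (2 * n), f k = (∏ k ∈ range n, f (2 * k)) * ∏ k ∈ range n, f (2 * k + 1) := by
  induction n with
  | zero => simp
  | succ n ih =>
    rw [show 2 * (n + 1) = 2 * n + 1 + 1 by ring, prod_range_succ, prod_range_succ, ih,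
      prod_range_succ, prod_range_succ]
    simp only [mul_assoc, mul_comm, mul_left_comm]

theorem tendsto_prod_one_sub_oddInvSq {w : ℝ} (h0 : 0 < w) (h1 : w < 1) :
    Tendsto (fun N => ∏ k ∈ range N, (1 + -w ^ 2 * oddInvSq k)) atTop
      (𝓝 (Real.cos (Real.pi / 2 * w))) := by
  have hpi := Real.pi_pos
  have hs : 0 < Real.sin (Real.pi * (w / 2)) :=
    Real.sin_pos_of_pos_of_lt_pi (by positivity) (by nlinarith)
  have hdbl : Tendsto (fun n : ℕ => 2 * n) atTop atTop :=
    tendsto_id.const_mul_atTop' two_pos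
  have hA := (Real.tendsto_euler_sin_prod w).comp hdbl
  have hB := Real.tendsto_euler_sin_prod (w / 2)
  have hAB := (hA.div hB hs.ne').mul_const (1 / 2)
  have e : Real.sin (Real.pi * w) / Real.sin (Real.pi * (w / 2)) * (1 / 2)
      = Real.cos (Real.pi / 2 * w) := by
    rw [show Real.pi * w = 2 * (Real.pi * (w / 2)) by ring, Real.sin_two_mul,
      show Real.pi / 2 * w = Real.pi * (w / 2) by ring]
    generalize Real.sin (Real.pi * (w / 2)) = y at hs ⊢
    field_simp
  rw [e] at hAB
  refine hAB.congr fun N => ?_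
  have e1 : ∏ k ∈ range N, (1 - w ^ 2 / (((2 * k + 1 : ℕ) : ℝ) + 1) ^ 2)
      = ∏ k ∈ range N, (1 - (w / 2) ^ 2 / ((k : ℝ) + 1) ^ 2) := by
    refine prod_congr rfl fun k _ => ?_
    have : (k : ℝ) + 1 ≠ 0 := by positivity
    push_cast
    rw [show (2 * (k : ℝ) + 1 + 1) = 2 * (k + 1) by ring]
    field_simp
  have e2 : ∏ k ∈ range N, (1 - w ^ 2 / (((2 * k : ℕ) : ℝ) + 1) ^ 2)
      = ∏ k ∈ range N, (1 + -w ^ 2 * oddInvSq k) := by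
    refine prod_congr rfl fun k _ => ?_
    rw [oddInvSq]; push_cast; ring
  have hne : ∏ k ∈ range N, (1 - (w / 2) ^ 2 / ((k : ℝ) + 1) ^ 2) ≠ 0 := by
    refine (prod_pos fun k _ => ?_).ne'
    rw [sub_pos, div_lt_one (by positivity)]
    have : (0 : ℝ) ≤ k := k.cast_nonneg
    nlinarith
  simp only [Function.comp_apply, Pi.div_apply]
  rw [prod_range_two_mul, e1, e2]
  generalize ∏ k ∈ range N, (1 - (w / 2) ^ 2 / ((k : ℝ) + 1) ^ 2) = y at hne ⊢
  generalize ∏ k ∈ range N, (1 + -w ^ 2 * oddInvSq k) = z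
  field_simp

/-- Uniqueness of power series coefficients from agreement on a left half-neighbourhood of `0`. -/
theorem eq_zero_of_hasSum_pow {c : ℕ → ℝ} (hc : ∀ x : ℝ, Summable fun i => c i * x ^ i)
    (h : ∀ x ∈ Set.Ioo (-1 : ℝ) 0, HasSum (fun i => c i * x ^ i) 0) : c = 0 := by
  have hp : HasFPowerSeriesAt (fun x : ℝ => ∑' i, c i * x ^ i) (FormalMultilinearSeries.ofScalars ℝ c) 0 := by
    rw [hasFPowerSeriesAt_iff]
    refine Eventually.of_forall fun x => ?_
    simp only [FormalMultilinearSeries.coeff_ofScalars, smul_eq_mul, zero_add]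
    exact (hc x).hasSum.congr_fun fun i => mul_comm _ _
  have hf : ∃ᶠ x in 𝓝[≠] (0 : ℝ), ∑' i, c i * x ^ i = 0 := by
    have : ∃ᶠ x in 𝓝[<] (0 : ℝ), ∑' i, c i * x ^ i = 0 :=
      (Filter.Eventually.frequently (by
        filter_upwards [Ioo_mem_nhdsLT (show (-1 : ℝ) < 0 by norm_num)] with x hx
        exact (h x hx).tsum_eq))
    exact this.filter_mono (nhdsWithin_mono _ fun x hx => ne_of_lt hx)
  have h2 := hp.eq_zero_of_eventually (hp.analyticAt.frequently_zero_iff_eventually_zero.1 hf)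
  exact (FormalMultilinearSeries.ofScalars_series_eq_zero ℝ).1 h2

theorem hasSum_prod_oddInvSq (i : ℕ) :
    HasSum (fun s : {s : Finset ℕ // #s = i} => ∏ k ∈ s.1, oddInvSq k)
      ((Real.pi / 2) ^ (2 * i) / (2 * i).factorial) := by
  have hsum := summable_finsetProd_of_summable_nonneg oddInvSq_nonneg summable_oddInvSq
  set c : ℕ → ℝ := fun i => ∑' s : {s : Finset ℕ // #s = i}, ∏ k ∈ s.1, oddInvSq k with hcdef
  have hfib : ∀ x : ℝ, HasSum (fun i => c i * x ^ i) (∑' s : Finset ℕ, ∏ k ∈ s, (x * oddInvSq k)) := by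
    intro x
    have hx : Summable fun s : Finset ℕ => ∏ k ∈ s, (x * oddInvSq k) :=
      summable_finsetProd_of_summable_norm (summable_oddInvSq.mul_left x).norm
    refine (hx.hasSum.tsum_fiberwise card).congr_fun fun i => ?_
    rw [hcdef, ← tsum_mul_right]
    refine tsum_congr fun s => ?_
    rw [prod_mul_distrib, prod_const, mul_comm, show #s.1 = i from s.2]
  have hcos : ∀ x ∈ Set.Ioo (-1 : ℝ) 0,
      HasSum (fun i => (Real.pi / 2) ^ (2 * i) / (2 * i).factorial * x ^ i)
        (∑' s : Finset ℕ, ∏ k ∈ s, (x * oddInvSq k)) := by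
    intro x hx
    have hx' : Summable fun s : Finset ℕ => ∏ k ∈ s, (x * oddInvSq k) :=
      summable_finsetProd_of_summable_norm (summable_oddInvSq.mul_left x).norm
    have hw : x = - (√(-x)) ^ 2 := by rw [Real.sq_sqrt (by linarith [hx.2])]; ring
    have h1 := (hasProd_one_add_of_hasSum_prod hx'.hasSum).tendsto_prod_nat
    have h2 := tendsto_prod_one_sub_oddInvSq (w := √(-x)) (Real.sqrt_pos.2 (by linarith [hx.2]))
      ((Real.sqrt_lt' one_pos).2 (by linarith [hx.1]))
    rw [← hw] at h2
    rw [tendsto_nhds_unique h1 h2]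
    refine (Real.hasSum_cos _).congr_fun fun i => ?_
    rw [mul_pow, pow_mul (√(-x)), Real.sq_sqrt (by linarith [hx.2]), neg_pow x]
    have : ((-1 : ℝ) ^ i) * (-1) ^ i = 1 := by rw [← mul_pow]; simp
    linear_combination -(Real.pi / 2) ^ (2 * i) / (2 * i).factorial * x ^ i * this
  have hcos' : ∀ x : ℝ, Summable fun i : ℕ => (Real.pi / 2) ^ (2 * i) / (2 * i).factorial * x ^ i := by
    intro x
    refine Summable.of_norm_bounded ((Real.hasSum_cosh (Real.pi / 2 * √|x|)).summable) fun i => ?_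
    rw [mul_pow, pow_mul (√|x|), Real.sq_sqrt (abs_nonneg x), norm_mul, norm_pow, Real.norm_eq_abs,
      Real.norm_eq_abs, abs_of_nonneg (by have := Real.pi_pos; positivity), div_mul_eq_mul_div]
  have hz := eq_zero_of_hasSum_pow (c := fun i => c i - (Real.pi / 2) ^ (2 * i) / (2 * i).factorial)
    (fun x => by simpa only [sub_mul] using (hfib x).summable.sub (hcos' x))
    (fun x hx => by simpa only [sub_mul, sub_self] using (hfib x).sub (hcos x hx))
  rw [← sub_eq_zero.1 (congrFun hz i)]
  exact (hsum.comp_injective (Subtype.val_injective (p := fun s : Finset ℕ => #s = i))).hasSum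

/-- The Taylor coefficients of `cos (π √((1 - y) x) / 2)` with respect to `y ^ d`. -/
noncomputable def cosSeries (d : ℕ) : PowerSeries ℝ :=
  PowerSeries.mk fun n =>
    (-1) ^ (n + d) * n.choose d * ((Real.pi / 2) ^ (2 * n) / (2 * n).factorial)

theorem cosSeries_zero_mul_mk_Tsum (d : ℕ) :
    cosSeries 0 * PowerSeries.mk (fun n => Tsum n d) = cosSeries d := by
  have he : ∀ i, Tendsto (fun N => ∑ s ∈ (range N).powersetCard i, ∏ k ∈ s, oddInvSq k) atTop
      (𝓝 ((Real.pi / 2) ^ (2 * i) / (2 * i).factorial)) :=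
    fun i => tendsto_sum_powersetCard (hasSum_prod_oddInvSq i)
  have hE : ∀ n, Tendsto (fun N => PowerSeries.coeff n
      (∏ k ∈ range N, (1 - PowerSeries.C (oddInvSq k) * PowerSeries.X))) atTop
      (𝓝 (PowerSeries.coeff n (cosSeries 0))) := by
    intro n
    have h := fun N => prod_mul_sum_powersetCard (range N) oddInvSq 0
    simp only [powersetCard_zero, sum_singleton, prod_empty, mul_one] at h
    simp only [h, cosSeries, PowerSeries.coeff_mk]
    exact (he n).const_mul _
  ext n
  have h1 : Tendsto (fun N => PowerSeries.coeff n
      ((∏ k ∈ range N, (1 - PowerSeries.C (oddInvSq k) * PowerSeries.X)) *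
        ∑ s ∈ (range N).powersetCard d, ∏ k ∈ s, geomTail (oddInvSq k))) atTop
      (𝓝 (PowerSeries.coeff n (cosSeries 0 * PowerSeries.mk (fun n => Tsum n d)))) := by
    simp only [PowerSeries.coeff_mul]
    refine tendsto_finsetSum _ fun p _ => (hE p.1).mul ?_
    rw [PowerSeries.coeff_mk]
    exact tendsto_coeff_sum_powersetCard p.2 d
  refine tendsto_nhds_unique h1 ?_
  simp only [prod_mul_sum_powersetCard, cosSeries, PowerSeries.coeff_mk]
  exact (he n).const_mul _

theorem cosSeries_recurrence (d : ℕ) :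
    (4 * (d + 2) * (d + 1) : ℝ) • cosSeries (d + 2)
      = ((4 * d + 2) * (d + 1) : ℝ) • cosSeries (d + 1)
        - (Real.pi ^ 2 / 4) • (PowerSeries.X * cosSeries d) := by
  ext n
  rcases n with _ | n
  · simp [cosSeries]
  · simp only [map_sub, PowerSeries.coeff_smul, PowerSeries.coeff_succ_X_mul, cosSeries,
      PowerSeries.coeff_mk, smul_eq_mul]
    have h1 : ((n + 1 : ℕ) : ℝ) * n.choose d = (n + 1).choose (d + 1) * (d + 1) := by
      exact_mod_cast Nat.add_one_mul_choose_eq n d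
    have h2 : ((n + 1).choose (d + 2) : ℝ) * (d + 2) = (n + 1).choose (d + 1) * (n - d) := by
      rcases le_or_gt d n with h | h
      · have := Nat.choose_succ_right_eq (n + 1) (d + 1)
        rw [show n + 1 - (d + 1) = n - d by omega] at this
        have h3 : ((n - d : ℕ) : ℝ) = n - d := by push_cast [h]; ring
        rw [← h3]; exact_mod_cast this
      · rw [Nat.choose_eq_zero_of_lt (by omega : n + 1 < d + 2),
          Nat.choose_eq_zero_of_lt (by omega : n + 1 < d + 1)]
        simp
    have h3 : (Real.pi / 2) ^ (2 * n) / (2 * n).factorial * (Real.pi ^ 2 / 4)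
        = (2 * n + 2) * (2 * n + 1) *
          ((Real.pi / 2) ^ (2 * (n + 1)) / (2 * (n + 1)).factorial) := by
      rw [show 2 * (n + 1) = 2 * n + 1 + 1 by ring, Nat.factorial_succ, Nat.factorial_succ]
      have := Nat.factorial_ne_zero (2 * n)
      push_cast
      field_simp
      ring
    have h4 : (-1 : ℝ) ^ (n + 1 + (d + 2)) = - (-1) ^ (n + d) := by ring
    have h5 : (-1 : ℝ) ^ (n + 1 + (d + 1)) = (-1) ^ (n + d) := by ring
    rw [h4, h5]
    push_cast at h1 h2
    generalize (Real.pi / 2) ^ (2 * (n + 1)) / ((2 * (n + 1)).factorial : ℝ) = y at *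
    linear_combination (-4 * (d + 1) * (-1) ^ (n + d) * y : ℝ) * h2
      + ((-1) ^ (n + d) * n.choose d) * h3 + ((-1) ^ (n + d) * y * 2 * (2 * n + 1)) * h1

theorem Tsum_recurrence (n d : ℕ) :
    4 * (d + 2) * (d + 1) * Tsum (n + 1) (d + 2)
      = (4 * d + 2) * (d + 1) * Tsum (n + 1) (d + 1) - Real.pi ^ 2 / 4 * Tsum n d := by
  have hne : cosSeries 0 ≠ 0 := fun h => by
    have := congrArg (PowerSeries.coeff 0) h
    simp [cosSeries] at this
  have h := cosSeries_recurrence d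
  simp only [← cosSeries_zero_mul_mk_Tsum (d + 2), ← cosSeries_zero_mul_mk_Tsum (d + 1),
    ← cosSeries_zero_mul_mk_Tsum d, mul_left_comm PowerSeries.X, ← mul_smul_comm, ← mul_sub] at h
  have h2 := congrArg (PowerSeries.coeff (n + 1)) (mul_left_cancel₀ hne h)
  simpa [PowerSeries.coeff_succ_X_mul] using h2

theorem Tsum_zero {n : ℕ} (hn : n ≠ 0) : Tsum n 0 = 0 := by
  obtain ⟨m, rfl⟩ := Nat.exists_eq_succ_of_ne_zero hn
  simp [Tsum]

theorem Tsum_one {n : ℕ} (hn : n ≠ 0) : Tsum n 1 = t1 n := by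
  have h : (Finset.Nat.antidiagonalTuple 1 n).filter (fun j => ∀ i, 1 ≤ j i) = {![n]} := by
    rw [Finset.Nat.antidiagonalTuple_one, filter_singleton]
    simp [Nat.one_le_iff_ne_zero, hn]
  rw [Tsum, h, sum_singleton, mtv, t1]
  let e : {f : Fin 1 → ℕ // StrictAnti f} ≃ ℕ :=
    (Equiv.subtypeUnivEquiv fun f => Subsingleton.strictAnti f).trans (Equiv.funUnique (Fin 1) ℕ)
  rw [← e.tsum_eq]
  simp [e]

/-- The coefficient of `t1 (n - j)` in `Tsum n (m + 1)`. -/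
noncomputable def sumFormulaCoeff (m j : ℕ) : ℝ :=
  if j ≤ m then
    (2 * (m - j)).choose m * ((-1) ^ j * Real.pi ^ (2 * j) / (2 * j).factorial) / (4 ^ m * (m + 1))
  else 0

theorem choose_recurrence (p m : ℕ) :
    (m + 1) * (m + 2) * ((2 * p + 2).choose (m + 2) : ℝ)
      = (4 * m + 6) * (m + 1) * (2 * p).choose (m + 1)
        + (2 * m + 2 - 2 * p) * (2 * m + 1 - 2 * p) * (2 * p).choose m := by
  have key : ∀ a b : ℕ, (a.choose (b + 1) : ℝ) * (b + 1) = a.choose b * (a - b) := by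
    intro a b
    rcases le_or_gt b a with h | h
    · have := Nat.choose_succ_right_eq a b
      have h3 : ((a - b : ℕ) : ℝ) = a - b := by push_cast [h]; ring
      rw [← h3]; exact_mod_cast this
    · rw [Nat.choose_eq_zero_of_lt h, Nat.choose_eq_zero_of_lt (by omega : a < b + 1)]
      simp
  have h1 := key (2 * p) m
  have h2 := key (2 * p) (m + 1)
  have h3 : ((2 * p + 2).choose (m + 2) : ℝ)
      = (2 * p).choose m + 2 * (2 * p).choose (m + 1) + (2 * p).choose (m + 2) := by
    rw [Nat.choose_succ_succ' (2 * p + 1), Nat.choose_succ_succ' (2 * p),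
      Nat.choose_succ_succ' (2 * p)]
    push_cast; ring
  rw [h3]
  push_cast at h1 h2
  linear_combination (m + 1) * h2 + (2 * p - (m + 1) + 2 * (m + 2) - (4 * m + 6)) * h1

theorem sumFormulaCoeff_zero_right (m : ℕ) :
    4 * (m + 3) * (m + 2) * sumFormulaCoeff (m + 2) 0
      = (4 * m + 6) * (m + 2) * sumFormulaCoeff (m + 1) 0 := by
  have h := choose_recurrence (m + 1) m
  simp only [sumFormulaCoeff, Nat.zero_le, if_true, Nat.sub_zero]
  rw [show 2 * (m + 2) = 2 * (m + 1) + 2 by ring]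
  push_cast at h ⊢
  simp only [pow_add, pow_zero, Nat.factorial_zero, Nat.cast_one]
  field_simp
  apply mul_left_cancel₀ (show (m + 1 : ℝ) ≠ 0 by positivity)
  linear_combination (m + 3) * h

theorem sumFormulaCoeff_succ (m j : ℕ) :
    4 * (m + 3) * (m + 2) * sumFormulaCoeff (m + 2) (j + 1)
      = (4 * m + 6) * (m + 2) * sumFormulaCoeff (m + 1) (j + 1)
        - Real.pi ^ 2 / 4 * sumFormulaCoeff m j := by
  rcases le_or_gt j m with hj | hj
  · obtain ⟨p, rfl⟩ := Nat.exists_eq_add_of_le hj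
    have h := choose_recurrence p (j + p)
    simp only [sumFormulaCoeff]
    rw [if_pos (by omega), if_pos (by omega), if_pos (by omega),
      show 2 * (j + p + 2 - (j + 1)) = 2 * p + 2 by omega,
      show 2 * (j + p + 1 - (j + 1)) = 2 * p by omega, show 2 * (j + p - j) = 2 * p by omega,
      show 2 * (j + 1) = 2 * j + 1 + 1 by ring, Nat.factorial_succ, Nat.factorial_succ]
    have := Nat.factorial_ne_zero (2 * j)
    push_cast at h ⊢
    field_simp
    linear_combination (-64 * (j + p + 3) * (j + p + 2) * (4 ^ (j + p)) ^ 2 * (-1) ^ j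
      * Real.pi ^ (2 * j + 2) : ℝ) * h
  · rcases Nat.lt_or_ge (m + 1) j with h | h
    · simp [sumFormulaCoeff, show ¬ j ≤ m by omega, show ¬ j + 1 ≤ m + 2 by omega]
    · obtain rfl : j = m + 1 := by omega
      simp [sumFormulaCoeff]

theorem Tsum_eq_sum (m : ℕ) : ∀ n, m + 1 ≤ n →
    Tsum n (m + 1) = ∑ j ∈ range (m + 1), sumFormulaCoeff m j * t1 (n - j) := by
  have ext : ∀ m K n, m + 1 ≤ K → ∑ j ∈ range K, sumFormulaCoeff m j * t1 (n - j)
      = ∑ j ∈ range (m + 1), sumFormulaCoeff m j * t1 (n - j) := by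
    intro m K n hK
    refine (sum_subset (range_subset_range.2 hK) fun j _ hj => ?_).symm
    rw [mem_range, not_lt] at hj
    rw [sumFormulaCoeff, if_neg (by omega), zero_mul]
  induction m using Nat.twoStepInduction with
  | zero =>
    intro n hn
    simp [Tsum_one (by omega : n ≠ 0), sumFormulaCoeff]
  | one =>
    intro n hn
    obtain ⟨n, rfl⟩ := Nat.exists_eq_add_of_le' hn
    have h := Tsum_recurrence (n + 1) 0
    rw [Tsum_zero (by omega), Tsum_one (by omega)] at h
    simp [sum_range_succ, sumFormulaCoeff] at h ⊢
    linarith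
  | more m ih1 ih2 =>
    intro n hn
    obtain ⟨n, rfl⟩ := Nat.exists_eq_add_of_le' (show 1 ≤ n by omega)
    have h := Tsum_recurrence n (m + 1)
    rw [ih1 n (by omega), ih2 (n + 1) (by omega), ← ext (m + 1) (m + 3) _ (by omega),
      ← ext m (m + 2) _ (by omega), sum_range_succ' _ (m + 2)] at h
    have hc : (4 * (m + 3) * (m + 2) : ℝ) ≠ 0 := by positivity
    apply mul_left_cancel₀ hc
    rw [sum_range_succ' _ (m + 2), mul_add _ (∑ k ∈ range (m + 2), _), mul_sum,
      ← mul_assoc _ (sumFormulaCoeff (m + 2) 0),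
      sumFormulaCoeff_zero_right]
    simp only [← mul_assoc, sumFormulaCoeff_succ]
    simp only [sub_mul, sum_sub_distrib, Nat.add_sub_add_right]
    simp only [mul_assoc, ← mul_sum]
    push_cast at h
    linear_combination h

theorem t1_eq_bernoulli {j : ℕ} (hj : j ≠ 0) :
    t1 j = (2 ^ (2 * j) - 1) * bernoulli (2 * j) *
      ((-1) ^ (j + 1) * Real.pi ^ (2 * j) / (2 * (2 * j).factorial)) := by
  have hz := hasSum_zeta_nat hj
  have ho := (hz.summable.comp_injective (i := fun k : ℕ => 2 * k + 1) fun a b h => by simpa using h).hasSum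
  have he : HasSum (fun k : ℕ => 1 / ((2 * k : ℕ) : ℝ) ^ (2 * j)) (1 / 2 ^ (2 * j) * _) :=
    (hz.mul_left (1 / 2 ^ (2 * j))).congr_fun fun k => by push_cast; rw [mul_pow]; ring
  have h := (he.even_add_odd (f := fun n : ℕ => 1 / (n : ℝ) ^ (2 * j)) ho).unique hz
  have ht : t1 j = ∑' k : ℕ, ((fun n : ℕ => 1 / (n : ℝ) ^ (2 * j)) ∘ fun k => 2 * k + 1) k :=
    tsum_congr fun k => by simp
  rw [ht, eq_sub_iff_add_eq'.2 h]
  obtain ⟨i, rfl⟩ := Nat.exists_eq_succ_of_ne_zero hj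
  rw [show 2 * i.succ - 1 = 2 * i + 1 by omega, show 2 * i.succ = 2 * i + 2 by rfl]
  field_simp
  ring

theorem bernoulli_two_mul_ne_zero {j : ℕ} (hj : j ≠ 0) : bernoulli (2 * j) ≠ 0 := by
  intro h
  have hz := hasSum_zeta_nat hj
  rw [h] at hz
  have := le_hasSum hz 1 fun n _ => by positivity
  simp at this
  linarith

theorem sumFormulaCoeff_eq_neg_t1_div {m j : ℕ} (hj : j ≠ 0) (hm : 2 * j ≤ m) :
    sumFormulaCoeff m j
      = - ((2 * (m + 1) - 2 * j - 2).choose m * t1 j /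
        (2 ^ (2 * (m + 1) - 3) * (2 ^ (2 * j) - 1) * bernoulli (2 * j) * ((m + 1 : ℕ) : ℝ))) := by
  have hB : (bernoulli (2 * j) : ℝ) ≠ 0 := by exact_mod_cast bernoulli_two_mul_ne_zero hj
  have h2 : (2 ^ (2 * j) - 1 : ℝ) ≠ 0 :=
    (sub_pos.2 (one_lt_pow₀ one_lt_two (by omega))).ne'
  have h4 : (4 : ℝ) ^ m = 2 ^ (2 * (m + 1) - 3) * 2 := by
    rw [← pow_succ, show 2 * (m + 1) - 3 + 1 = 2 * m by omega, pow_mul]; norm_num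
  rw [t1_eq_bernoulli hj, sumFormulaCoeff, if_pos (by omega), h4,
    show 2 * (m + 1) - 2 * j - 2 = 2 * (m - j) by omega]
  push_cast
  field_simp
  ring

/-- Sum formula for multiple t-values at even arguments (Theorem 1.1, second form),
with the lower-weight contributions expressed via Bernoulli numbers. -/
theorem T2n_d_sum_formula_bernoulli (n d : ℕ) (hd : 1 ≤ d) (hdn : d ≤ n) :
    Tsum n d = ((2 * d - 2).choose (d - 1)) * t1 n / (2 ^ (2 * d - 2) * d)
      - ∑ j ∈ Finset.Icc 1 ((d - 1) / 2),
          ((2 * d - 2 * j - 2).choose (d - 1)) * (t1 j * t1 (n - j)) /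
            (2 ^ (2 * d - 3) * (2 ^ (2 * j) - 1) * ((bernoulli (2 * j) : ℚ) : ℝ) * d) := by
  obtain ⟨m, rfl⟩ := Nat.exists_eq_add_of_le' hd
  rw [Tsum_eq_sum m n hdn, sub_eq_add_neg, ← sum_neg_distrib, Nat.add_sub_cancel]
  have hsub : insert 0 (Icc 1 (m / 2)) ⊆ range (m + 1) := fun j hj => by
    simp only [mem_insert, mem_Icc, mem_range] at hj ⊢; omega
  rw [← sum_subset hsub fun j hj hj' => ?_, sum_insert (by simp)]
  · congr 1
    · rw [sumFormulaCoeff, if_pos m.zero_le, show 2 * (m + 1) - 2 = 2 * m by omega,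
        show (4 : ℝ) ^ m = 2 ^ (2 * m) by rw [pow_mul]; norm_num]
      norm_num
      ring
    · refine sum_congr rfl fun j hj => ?_
      rw [mem_Icc] at hj
      rw [sumFormulaCoeff_eq_neg_t1_div (by omega) (by omega)]
      ring
  · simp only [mem_insert, mem_Icc, mem_range] at hj hj'
    rw [sumFormulaCoeff, Nat.choose_eq_zero_of_lt (by omega)]
    simp
end

section
/- For all real numbers u and v with 0 ≤ u < 1 and 0 ≤ v ≤ 1, the generating function of the sums T(2n,d) satisfies 1 + Σ_{n=1}^∞ (Σ_{d=1}^{n} T(2n,d) v^d) u^n = cos((π/2)·√((1-v)u)) / cos((π/2)·√u). -/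
open scoped BigOperators

open Filter Topology ENNReal

theorem prod_range_two_mul_one_sub_sq_div (z : ℝ) (N : ℕ) :
    ∏ j ∈ Finset.range (2 * N), (1 - z ^ 2 / ((j : ℝ) + 1) ^ 2) =
      (∏ k ∈ Finset.range N, (1 - z ^ 2 / (2 * (k : ℝ) + 1) ^ 2)) *
        ∏ k ∈ Finset.range N, (1 - (z / 2) ^ 2 / ((k : ℝ) + 1) ^ 2) := by
  induction N with
  | zero => simp
  | succ N ih =>
    rw [mul_add, mul_one, Finset.prod_range_succ, Finset.prod_range_succ, ih,
      Finset.prod_range_succ, Finset.prod_range_succ]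
    have h : z ^ 2 / (((2 * N + 1 : ℕ) : ℝ) + 1) ^ 2 = (z / 2) ^ 2 / ((N : ℝ) + 1) ^ 2 := by
      have : (N : ℝ) + 1 ≠ 0 := by positivity
      push_cast
      field_simp
      ring
    rw [h]
    push_cast
    ring

theorem tendsto_cos_prod {z : ℝ} (hz0 : 0 ≤ z) (hz1 : z < 1) :
    Tendsto (fun N ↦ ∏ k ∈ Finset.range N, (1 - z ^ 2 / (2 * (k : ℝ) + 1) ^ 2)) atTop
      (𝓝 (Real.cos (Real.pi / 2 * z))) := by
  rcases hz0.eq_or_lt with rfl | hz0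
  · simp
  have hs : Real.sin (Real.pi * (z / 2)) ≠ 0 :=
    (Real.sin_pos_of_pos_of_lt_pi (by positivity) (by nlinarith [Real.pi_pos])).ne'
  have h1 := (Real.tendsto_euler_sin_prod z).comp (tendsto_id.const_mul_atTop' (two_pos (α := ℕ)))
  have h2 := Real.tendsto_euler_sin_prod (z / 2)
  have h3 := (h1.div h2 hs).div_const 2
  have e : Real.sin (Real.pi * z) / Real.sin (Real.pi * (z / 2)) / 2 =
      Real.cos (Real.pi / 2 * z) := by
    rw [show Real.pi * z = 2 * (Real.pi * (z / 2)) by ring, Real.sin_two_mul,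
      show Real.pi / 2 * z = Real.pi * (z / 2) by ring, mul_assoc,
      mul_div_assoc, mul_div_cancel_left₀ _ hs, mul_div_cancel_left₀ _ two_ne_zero]
  rw [e] at h3
  refine h3.congr' ?_
  filter_upwards [h2.eventually_ne hs] with N hN
  have hP := right_ne_zero_of_mul hN
  simp only [Pi.div_apply, Function.comp_apply, id, prod_range_two_mul_one_sub_sq_div]
  rw [← mul_assoc, mul_div_mul_right _ _ hP]
  have := Real.pi_ne_zero
  have := hz0.ne'
  generalize ∏ k ∈ Finset.range N, (1 - z ^ 2 / (2 * (k : ℝ) + 1) ^ 2) = Q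
  field_simp

theorem ENNReal.tsum_pi_prod (d : ℕ) (F : Fin d → ℕ → ℝ≥0∞) :
    ∑' j : Fin d → ℕ, ∏ i, F i (j i) = ∏ i, ∑' m, F i m := by
  induction d with
  | zero => simp
  | succ d ih =>
    rw [← (Fin.consEquiv fun _ ↦ ℕ).tsum_eq, ENNReal.tsum_prod', Fin.prod_univ_succ, ← ih]
    simp [Fin.consEquiv, Fin.prod_univ_succ, ENNReal.tsum_mul_left, ENNReal.tsum_mul_right]

theorem bijective_strictAnti_image {α : Type*} [LinearOrder α] :
    Function.Bijective fun p : (Σ d : ℕ, {f : Fin d → α // StrictAnti f}) ↦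
      Finset.univ.image p.2.1 := by
  refine ⟨?_, fun S ↦ ?_⟩
  · rintro ⟨d, f, hf⟩ ⟨e, g, hg⟩ h
    dsimp only at h
    obtain rfl : d = e := by
      simpa [Finset.card_image_of_injective, hf.injective, hg.injective] using
        congrArg Finset.card h
    have : f = g := (hf.range_inj hg).1 (by simpa using congrArg ((↑) : Finset α → Set α) h)
    subst this
    rfl
  · refine ⟨⟨S.card, S.orderEmbOfFin rfl ∘ Fin.rev,
      (S.orderEmbOfFin rfl).strictMono.comp_strictAnti Fin.rev_strictAnti⟩, ?_⟩
    apply Finset.coe_injective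
    rw [Finset.coe_image, Finset.coe_univ, Set.image_univ, Fin.rev_surjective.range_comp,
      Finset.range_orderEmbOfFin]

theorem ENNReal.tsum_strictAnti_prod (g : ℕ → ℝ≥0∞) :
    ∑' d : ℕ, ∑' f : {f : Fin d → ℕ // StrictAnti f}, ∏ i, g (f.1 i) =
      ∑' S : Finset ℕ, ∏ k ∈ S, g k := by
  rw [← (Equiv.ofBijective _ (bijective_strictAnti_image (α := ℕ))).tsum_eq, ENNReal.tsum_sigma']
  refine tsum_congr fun d ↦ tsum_congr fun f ↦ ?_
  simp [Finset.prod_image f.2.injective.injOn]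

theorem ENNReal.tsum_finset_prod_ofReal {g : ℕ → ℝ} (hg : ∀ k, 0 ≤ g k) (hs : Summable g) :
    ∑' S : Finset ℕ, ∏ k ∈ S, ENNReal.ofReal (g k) = ENNReal.ofReal (∏' k, (1 + g k)) := by
  have h := summable_finsetProd_of_summable_nonneg hg hs
  rw [tprod_one_add h, ENNReal.ofReal_tsum_of_nonneg (fun S ↦ Finset.prod_nonneg fun k _ ↦ hg k) h]
  simp only [ENNReal.ofReal_prod_of_nonneg fun k _ ↦ hg k]

theorem summable_one_div_odd_sq : Summable fun k : ℕ ↦ 1 / (2 * (k : ℝ) + 1) ^ 2 := by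
  refine (((summable_nat_add_iff 1).2
    (Real.summable_one_div_nat_pow.2 one_lt_two))).of_nonneg_of_le (fun k ↦ by positivity)
    fun k ↦ ?_
  push_cast
  gcongr
  linarith [(k.cast_nonneg : (0 : ℝ) ≤ k)]

theorem tprod_one_add_eq_cos_div_cos {u v : ℝ} (hu0 : 0 ≤ u) (hu1 : u < 1)
    (hv0 : 0 ≤ v) (hv1 : v ≤ 1) {x : ℕ → ℝ} (hx : ∀ k, x k = u / (2 * (k : ℝ) + 1) ^ 2) :
    Summable (fun k ↦ v * (x k / (1 - x k))) ∧ ∏' k, (1 + v * (x k / (1 - x k))) =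
      Real.cos (Real.pi / 2 * Real.sqrt ((1 - v) * u)) /
          Real.cos (Real.pi / 2 * Real.sqrt u) := by
  have hx0 : ∀ k, 0 ≤ x k := fun k ↦ by rw [hx]; positivity
  have hxu : ∀ k, x k ≤ u := fun k ↦ by
    rw [hx]
    exact div_le_self hu0 (one_le_pow₀ (by linarith [(k.cast_nonneg : (0 : ℝ) ≤ k)]))
  have hsx : Summable x := by
    simpa only [funext hx, mul_one_div] using summable_one_div_odd_sq.mul_left u
  have hg0 : ∀ k, 0 ≤ v * (x k / (1 - x k)) := fun k ↦
    mul_nonneg hv0 (div_nonneg (hx0 k) (by linarith [hxu k]))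
  have hs : Summable (fun k ↦ v * (x k / (1 - x k))) := by
    refine Summable.mul_left v ((hsx.div_const (1 - u)).of_nonneg_of_le
      (fun k ↦ div_nonneg (hx0 k) (by linarith [hxu k])) fun k ↦ ?_)
    exact div_le_div_of_nonneg_left (hx0 k) (by linarith) (by linarith [hxu k])
  refine ⟨hs, ?_⟩
  have hm := (multipliable_one_add_of_summable hs.norm).hasProd.tendsto_prod_nat
  refine tendsto_nhds_unique hm ?_
  have hsq : Real.sqrt u < 1 := by rwa [Real.sqrt_lt' one_pos, one_pow]
  have hw0 : 0 ≤ (1 - v) * u := mul_nonneg (by linarith) hu0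
  have hsq' : Real.sqrt ((1 - v) * u) < 1 := by
    rw [Real.sqrt_lt' one_pos, one_pow]; nlinarith
  have hc : Real.cos (Real.pi / 2 * Real.sqrt u) ≠ 0 :=
    (Real.cos_pos_of_mem_Ioo ⟨by nlinarith [Real.pi_pos, Real.sqrt_nonneg u],
      by nlinarith [Real.pi_pos]⟩).ne'
  have h := (tendsto_cos_prod (Real.sqrt_nonneg _) hsq').div
    (tendsto_cos_prod (Real.sqrt_nonneg _) hsq) hc
  refine h.congr fun N ↦ ?_
  simp only [Pi.div_apply]
  rw [← Finset.prod_div_distrib]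
  refine Finset.prod_congr rfl fun k _ ↦ ?_
  rw [Real.sq_sqrt hw0, Real.sq_sqrt hu0, mul_div_assoc, ← hx]
  have : 1 - x k ≠ 0 := by linarith [hxu k]
  field_simp
  ring

theorem mtv_eq_toReal (d : ℕ) (s : Fin d → ℕ) :
    mtv d s = (∑' f : {f : Fin d → ℕ // StrictAnti f},
      ∏ i, ENNReal.ofReal (1 / (2 * (f.1 i : ℝ) + 1) ^ s i)).toReal := by
  rw [mtv, ENNReal.tsum_toReal_eq fun f ↦ ENNReal.prod_ne_top fun _ _ ↦ ENNReal.ofReal_ne_top]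
  refine tsum_congr fun f ↦ ?_
  rw [ENNReal.toReal_prod]
  exact Finset.prod_congr rfl fun i _ ↦ (ENNReal.toReal_ofReal (by positivity)).symm

theorem ofReal_mtv {d : ℕ} {s : Fin d → ℕ} (hs : ∀ i, 2 ≤ s i) :
    ENNReal.ofReal (mtv d s) = ∑' f : {f : Fin d → ℕ // StrictAnti f},
      ∏ i, ENNReal.ofReal (1 / (2 * (f.1 i : ℝ) + 1) ^ s i) := by
  rw [mtv_eq_toReal, ENNReal.ofReal_toReal]
  refine ne_top_of_le_ne_top (b := ∑' S : Finset ℕ, ∏ k ∈ S,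
    ENNReal.ofReal (1 / (2 * (k : ℝ) + 1) ^ 2)) ?_ ?_
  · rw [ENNReal.tsum_finset_prod_ofReal (fun k ↦ by positivity) summable_one_div_odd_sq]
    exact ENNReal.ofReal_ne_top
  · rw [← ENNReal.tsum_strictAnti_prod fun k ↦ ENNReal.ofReal (1 / (2 * (k : ℝ) + 1) ^ 2)]
    refine le_trans ?_ (ENNReal.le_tsum d)
    refine ENNReal.tsum_le_tsum fun f ↦ Finset.prod_le_prod' fun i _ ↦ ?_
    gcongr
    · linarith [((f.1 i).cast_nonneg : (0 : ℝ) ≤ f.1 i)]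
    · exact hs i

theorem mtv_nonneg (d : ℕ) (s : Fin d → ℕ) : 0 ≤ mtv d s := by
  rw [mtv_eq_toReal]
  exact ENNReal.toReal_nonneg

theorem Tsum_nonneg (n d : ℕ) : 0 ≤ Tsum n d :=
  Finset.sum_nonneg fun _ _ ↦ mtv_nonneg _ _

theorem Tsum_eq_zero_of_lt {n d : ℕ} (h : n < d) : Tsum n d = 0 := by
  refine Finset.sum_eq_zero fun j hj ↦ ?_
  rw [Finset.mem_filter, Finset.Nat.mem_antidiagonalTuple] at hj
  have hd : d ≤ ∑ i, j i := by
    simpa using Finset.card_nsmul_le_sum Finset.univ j 1 fun i _ ↦ hj.2 i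
  omega

theorem Tsum_zero_right {n : ℕ} (h : n ≠ 0) : Tsum n 0 = 0 := by
  obtain ⟨n, rfl⟩ := Nat.exists_eq_succ_of_ne_zero h
  simp [Tsum]

theorem Tsum_zero_zero : Tsum 0 0 = 1 := by
  have : Unique {f : Fin 0 → ℕ // StrictAnti f} :=
    ⟨⟨⟨Fin.elim0, fun i ↦ i.elim0⟩⟩, fun _ ↦ Subsingleton.elim _ _⟩
  simp [Tsum, mtv]

theorem ofReal_Tsum_mul (n d : ℕ) {u v : ℝ} (hu0 : 0 ≤ u) :
    ENNReal.ofReal (Tsum n d) * ENNReal.ofReal v ^ d * ENNReal.ofReal u ^ n =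
      ∑ j ∈ Finset.Nat.antidiagonalTuple d n, ∑' f : {f : Fin d → ℕ // StrictAnti f}, ∏ i,
        if 1 ≤ j i then
          ENNReal.ofReal v * ENNReal.ofReal (u / (2 * (f.1 i : ℝ) + 1) ^ 2) ^ j i else 0 := by
  rw [Tsum, ENNReal.ofReal_sum_of_nonneg fun _ _ ↦ mtv_nonneg _ _, Finset.sum_mul, Finset.sum_mul,
    Finset.sum_filter]
  refine Finset.sum_congr rfl fun j hj ↦ ?_
  rw [Finset.Nat.mem_antidiagonalTuple] at hj
  split_ifs with hpos
  · rw [ofReal_mtv fun i ↦ by linarith [hpos i], ← ENNReal.tsum_mul_right, ← ENNReal.tsum_mul_right]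
    refine tsum_congr fun f ↦ ?_
    have hd : ENNReal.ofReal v ^ d = ∏ _i : Fin d, ENNReal.ofReal v := by simp
    rw [← hj, ← Finset.prod_pow_eq_pow_sum, hd, ← Finset.prod_mul_distrib,
      ← Finset.prod_mul_distrib]
    refine Finset.prod_congr rfl fun i _ ↦ ?_
    rw [if_pos (hpos i), mul_comm (ENNReal.ofReal _) (ENNReal.ofReal v), mul_assoc,
      ← ENNReal.ofReal_pow hu0, ← ENNReal.ofReal_mul (by positivity),
      ← ENNReal.ofReal_pow (by positivity), div_pow, ← pow_mul, one_div_mul_eq_div]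
  · push Not at hpos
    obtain ⟨i, hi⟩ := hpos
    refine (ENNReal.tsum_eq_zero.2 fun f ↦ Finset.prod_eq_zero (Finset.mem_univ i) ?_).symm
    rw [if_neg hi.not_ge]

theorem ENNReal.tsum_sum_antidiagonalTuple (d : ℕ) (G : (Fin d → ℕ) → ℝ≥0∞) :
    ∑' n, ∑ j ∈ Finset.Nat.antidiagonalTuple d n, G j = ∑' j, G j := by
  rw [← (Finset.Nat.sigmaAntidiagonalTupleEquivTuple d).tsum_eq, ENNReal.tsum_sigma']
  refine tsum_congr fun n ↦ ?_
  exact (Finset.tsum_subtype (Finset.Nat.antidiagonalTuple d n) G).symm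

theorem tsum_ite_one_le_mul_pow {v x : ℝ} (hv0 : 0 ≤ v) (hx0 : 0 ≤ x) (hx1 : x < 1) :
    ∑' m : ℕ, (if 1 ≤ m then ENNReal.ofReal v * ENNReal.ofReal x ^ m else 0) =
      ENNReal.ofReal (v * (x / (1 - x))) := by
  rw [tsum_eq_zero_add' ENNReal.summable]
  simp only [nonpos_iff_eq_zero, one_ne_zero, if_false, zero_add, Nat.le_add_left, if_true,
    ENNReal.tsum_mul_left, ENNReal.tsum_geometric_add_one]
  rw [ENNReal.ofReal_mul hv0, div_eq_mul_inv, ENNReal.ofReal_mul hx0,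
    ENNReal.ofReal_inv_of_pos (by linarith), ENNReal.ofReal_sub _ hx0, ENNReal.ofReal_one]

theorem tsum_ofReal_Tsum {u v : ℝ} (hu0 : 0 ≤ u) (hu1 : u < 1) (hv0 : 0 ≤ v) (hv1 : v ≤ 1) :
    ∑' n, ENNReal.ofReal ((∑ d ∈ Finset.range (n + 1), Tsum n d * v ^ d) * u ^ n) =
      ENNReal.ofReal (Real.cos (Real.pi / 2 * Real.sqrt ((1 - v) * u)) /
        Real.cos (Real.pi / 2 * Real.sqrt u)) := by
  have key (n : ℕ) : ENNReal.ofReal ((∑ d ∈ Finset.range (n + 1), Tsum n d * v ^ d) * u ^ n) =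
      ∑' d, ENNReal.ofReal (Tsum n d) * ENNReal.ofReal v ^ d * ENNReal.ofReal u ^ n := by
    rw [tsum_eq_sum (s := Finset.range (n + 1)), Finset.sum_mul, ENNReal.ofReal_sum_of_nonneg]
    · refine Finset.sum_congr rfl fun d _ ↦ ?_
      have := Tsum_nonneg n d
      rw [ENNReal.ofReal_mul (by positivity), ENNReal.ofReal_mul this, ENNReal.ofReal_pow hv0,
        ENNReal.ofReal_pow hu0]
    · intro d _
      have := Tsum_nonneg n d
      positivity
    · intro d hd
      rw [Tsum_eq_zero_of_lt (by simpa using hd)]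
      simp
  obtain ⟨hs, hp⟩ := tprod_one_add_eq_cos_div_cos hu0 hu1 hv0 hv1 fun _ ↦ rfl
  have hx0 (k : ℕ) : 0 ≤ u / (2 * (k : ℝ) + 1) ^ 2 := by positivity
  have hx1 (k : ℕ) : u / (2 * (k : ℝ) + 1) ^ 2 < 1 :=
    (div_le_self hu0 (one_le_pow₀ (by linarith [(k.cast_nonneg : (0 : ℝ) ≤ k)]))).trans_lt hu1
  rw [← hp, ← ENNReal.tsum_finset_prod_ofReal (fun k ↦ mul_nonneg hv0
    (div_nonneg (hx0 k) (sub_nonneg.2 (hx1 k).le))) hs, ← ENNReal.tsum_strictAnti_prod fun k ↦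
    ENNReal.ofReal (v * (u / (2 * (k : ℝ) + 1) ^ 2 / (1 - u / (2 * (k : ℝ) + 1) ^ 2)))]
  simp_rw [key]
  rw [ENNReal.tsum_comm]
  refine tsum_congr fun d ↦ ?_
  simp_rw [ofReal_Tsum_mul _ d hu0]
  rw [ENNReal.tsum_sum_antidiagonalTuple d, ENNReal.tsum_comm]
  refine tsum_congr fun f ↦ ?_
  rw [ENNReal.tsum_pi_prod d fun i m ↦ if 1 ≤ m then
    ENNReal.ofReal v * ENNReal.ofReal (u / (2 * (f.1 i : ℝ) + 1) ^ 2) ^ m else 0]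
  exact Finset.prod_congr rfl fun i _ ↦ tsum_ite_one_le_mul_pow hv0 (hx0 _) (hx1 _)

/-- Generating function of the sums `T(2n, d)` (Theorem 1.2):
`1 + ∑_{n ≥ 1} (∑_{d=1}^{n} T(2n,d) v^d) u^n = cos((π/2)√((1-v)u)) / cos((π/2)√u)`. -/
theorem T2n_d_generating_function (u v : ℝ) (hu0 : 0 ≤ u) (hu1 : u < 1)
    (hv0 : 0 ≤ v) (hv1 : v ≤ 1) :
    1 + ∑' n : ℕ, (∑ d ∈ Finset.Icc 1 (n + 1), Tsum (n + 1) d * v ^ d) * u ^ (n + 1)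
      = Real.cos (Real.pi / 2 * Real.sqrt ((1 - v) * u)) /
          Real.cos (Real.pi / 2 * Real.sqrt u) := by
  have h := tsum_ofReal_Tsum hu0 hu1 hv0 hv1
  have hF (n : ℕ) : 0 ≤ (∑ d ∈ Finset.range (n + 1), Tsum n d * v ^ d) * u ^ n :=
    mul_nonneg (Finset.sum_nonneg fun d _ ↦ mul_nonneg (Tsum_nonneg n d) (by positivity))
      (by positivity)
  have hsum : Summable fun n ↦ (∑ d ∈ Finset.range (n + 1), Tsum n d * v ^ d) * u ^ n := by
    refine (ENNReal.summable_toReal (h.trans_ne ENNReal.ofReal_ne_top)).congr fun n ↦ ?_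
    exact ENNReal.toReal_ofReal (hF n)
  have hsqrt {w : ℝ} (hw : w < 1) : 0 ≤ Real.cos (Real.pi / 2 * Real.sqrt w) := by
    have hw' : Real.sqrt w < 1 := by rwa [Real.sqrt_lt' one_pos, one_pow]
    exact Real.cos_nonneg_of_mem_Icc ⟨by nlinarith [Real.pi_pos, Real.sqrt_nonneg w],
      by nlinarith [Real.pi_pos]⟩
  rw [← ENNReal.ofReal_tsum_of_nonneg hF hsum, ENNReal.ofReal_eq_ofReal_iff (tsum_nonneg hF)
    (div_nonneg (hsqrt (by nlinarith)) (hsqrt hu1)), hsum.tsum_eq_zero_add] at h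
  rw [← h]
  congr 1
  · simp [Tsum_zero_zero]
  · refine tsum_congr fun n ↦ ?_
    rw [Finset.range_eq_Ico, Finset.sum_eq_sum_Ico_succ_bot (by omega),
      Tsum_zero_right n.succ_ne_zero, zero_mul, zero_add]
    rfl
end

section
/- For every real number u with 0 ≤ u < 1, one has 1 + Σ_{n=1}^{∞} (Σ_{d=1}^{n} T(2n,d)) u^n = 1 / cos(π√u / 2). -/
open scoped BigOperators

open Filter Topology in
/-- Euler's product for the cosine on `(0, 1)`. -/
theorem tendsto_euler_cos_prod {x : ℝ} (hx0 : 0 < x) (hx1 : x < 1) :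
    Tendsto (fun n : ℕ => ∏ k ∈ Finset.range n, (1 - x ^ 2 / (2 * (k : ℝ) + 1) ^ 2)) atTop
      (𝓝 (Real.cos (Real.pi * x / 2))) := by
  have hsin : 0 < Real.sin (Real.pi * (x / 2)) := by
    apply Real.sin_pos_of_pos_of_lt_pi
    · positivity
    · nlinarith [Real.pi_pos]
  have hdouble : Tendsto (fun n : ℕ => 2 * n) atTop atTop :=
    tendsto_id.const_mul_atTop' (by norm_num)
  have hfull := (Real.tendsto_euler_sin_prod x).comp hdouble
  have hhalf := Real.tendsto_euler_sin_prod (x / 2)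
  have hsplit (n : ℕ) :
      ∏ j ∈ Finset.range (2 * n), ((1 : ℝ) - x ^ 2 / ((j : ℝ) + 1) ^ 2) =
        (∏ j ∈ Finset.range n, (1 - (x / 2) ^ 2 / ((j : ℝ) + 1) ^ 2)) *
          ∏ k ∈ Finset.range n, (1 - x ^ 2 / (2 * (k : ℝ) + 1) ^ 2) := by
    induction n with
    | zero => simp
    | succ n ih =>
      rw [show 2 * (n + 1) = 2 * n + 1 + 1 by ring, Finset.prod_range_succ,
        Finset.prod_range_succ, ih, Finset.prod_range_succ, Finset.prod_range_succ]
      have : x ^ 2 / (((2 * n + 1 : ℕ) : ℝ) + 1) ^ 2 = (x / 2) ^ 2 / ((n : ℝ) + 1) ^ 2 := by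
        push_cast
        rw [show (2 * (n : ℝ) + 1 + 1) = 2 * (n + 1) by ring]
        field_simp
      rw [this]
      push_cast
      ring
  have hquot := (hfull.div hhalf hsin.ne').div_const 2
  have hlim : Real.sin (Real.pi * x) / Real.sin (Real.pi * (x / 2)) / 2 =
      Real.cos (Real.pi * x / 2) := by
    rw [show Real.pi * x = 2 * (Real.pi * (x / 2)) by ring, Real.sin_two_mul,
      show 2 * (Real.pi * (x / 2)) / 2 = Real.pi * (x / 2) by ring]
    generalize Real.pi * (x / 2) = y at hsin ⊢
    field_simp
  rw [hlim] at hquot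
  refine hquot.congr' ?_
  filter_upwards [hhalf.eventually_ne hsin.ne'] with n hn
  simp only [Function.comp_apply, Pi.div_apply]
  rw [hsplit]
  have h1 := right_ne_zero_of_mul hn
  have := Real.pi_pos.ne'
  generalize ∏ j ∈ Finset.range n, (1 - (x / 2) ^ 2 / ((j : ℝ) + 1) ^ 2) = a at h1 ⊢
  generalize ∏ k ∈ Finset.range n, (1 - x ^ 2 / (2 * (k : ℝ) + 1) ^ 2) = b
  field_simp

open Filter Topology in
theorem hasSum_finset_prod_sec {u : ℝ} (hu0 : 0 < u) (hu1 : u < 1) :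
    HasSum (fun s : Finset ℕ =>
        ∏ k ∈ s, u / (2 * (k : ℝ) + 1) ^ 2 / (1 - u / (2 * (k : ℝ) + 1) ^ 2))
      (1 / Real.cos (Real.pi * √u / 2)) := by
  have hle (k : ℕ) : u / (2 * (k : ℝ) + 1) ^ 2 ≤ u :=
    div_le_self hu0.le (one_le_pow₀ (by linarith [k.cast_nonneg (α := ℝ)]))
  have hpos (k : ℕ) : 0 < 1 - u / (2 * (k : ℝ) + 1) ^ 2 := by linarith [hle k]
  have hnonneg (k : ℕ) : 0 ≤ u / (2 * (k : ℝ) + 1) ^ 2 / (1 - u / (2 * (k : ℝ) + 1) ^ 2) :=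
    div_nonneg (by positivity) (hpos k).le
  have hodd : Summable fun k : ℕ => u / (1 - u) * (1 / (2 * (k : ℝ) + 1) ^ 2) := by
    refine Summable.mul_left _ ?_
    have h := (Real.summable_one_div_nat_pow.mpr one_lt_two).comp_injective
      (i := fun k : ℕ => 2 * k + 1) (fun a b h => by simpa using h)
    simpa [Function.comp_def] using h
  have hsum : Summable fun k : ℕ =>
      u / (2 * (k : ℝ) + 1) ^ 2 / (1 - u / (2 * (k : ℝ) + 1) ^ 2) := by
    refine Summable.of_nonneg_of_le hnonneg (fun k => ?_) hodd
    calc _ ≤ u / (2 * (k : ℝ) + 1) ^ 2 / (1 - u) :=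
          div_le_div_of_nonneg_left (by positivity) (by linarith) (by linarith [hle k])
      _ = _ := by ring
  have hfin := (summable_finsetProd_of_summable_nonneg hnonneg hsum).hasSum
  have hprod := (hasProd_one_add_of_hasSum_prod hfin).tendsto_prod_nat
  have hcos : 0 < Real.cos (Real.pi * √u / 2) := by
    have := Real.sqrt_nonneg u
    have : √u < 1 := by rw [Real.sqrt_lt' one_pos]; simpa
    apply Real.cos_pos_of_mem_Ioo
    constructor <;> nlinarith [Real.pi_pos]
  have heuler := (tendsto_euler_cos_prod (Real.sqrt_pos.mpr hu0)
    (by rw [Real.sqrt_lt' one_pos]; simpa)).inv₀ hcos.ne'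
  rw [Real.sq_sqrt hu0.le] at heuler
  rw [one_div, tendsto_nhds_unique heuler (hprod.congr fun n => ?_)]
  · exact hfin
  · rw [← Finset.prod_inv_distrib]
    refine Finset.prod_congr rfl fun k _ => ?_
    have := (hpos k).ne'
    refine (inv_eq_of_mul_eq_one_left ?_).symm
    rw [add_mul, div_mul_cancel₀ _ this]
    ring

/-- The image of a strictly decreasing tuple identifies such tuples with finsets of fixed card. -/
noncomputable def strictAntiEquivFinset (d : ℕ) :
    {f : Fin d → ℕ // StrictAnti f} ≃ {s : Finset ℕ // s.card = d} :=
  Equiv.ofBijective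
    (fun f => ⟨Finset.univ.image f.1, by
      rw [Finset.card_image_of_injective _ f.2.injective, Finset.card_univ, Fintype.card_fin]⟩)
    (by
      constructor
      · rintro ⟨f, hf⟩ ⟨g, hg⟩ h
        have himage : Finset.univ.image f = Finset.univ.image g := congrArg Subtype.val h
        have hrange : Set.range f = Set.range g := by
          simpa using congrArg (fun s : Finset ℕ => (s : Set ℕ)) himage
        have hcomp : f ∘ Fin.rev = g ∘ Fin.rev := by
          rw [← StrictMono.range_inj (hf.comp Fin.rev_strictAnti) (hg.comp Fin.rev_strictAnti),
            Fin.rev_surjective.range_comp, Fin.rev_surjective.range_comp, hrange]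
        exact Subtype.ext (Fin.rev_surjective.injective_comp_right hcomp)
      · rintro ⟨s, hs⟩
        refine ⟨⟨s.orderEmbOfFin hs ∘ Fin.rev,
          (s.orderEmbOfFin hs).strictMono.comp_strictAnti Fin.rev_strictAnti⟩, Subtype.ext ?_⟩
        apply Finset.coe_injective
        rw [Finset.coe_image, Finset.coe_univ, Set.image_univ, Fin.rev_surjective.range_comp,
          Finset.range_orderEmbOfFin])

open scoped ENNReal

theorem tsum_finset_prod_eq_tsum_strictAnti (g : ℕ → ℝ≥0∞) :
    ∑' s : Finset ℕ, ∏ k ∈ s, g k =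
      ∑' d : ℕ, ∑' f : {f : Fin d → ℕ // StrictAnti f}, ∏ i, g (f.1 i) := by
  rw [← (Equiv.sigmaFiberEquiv (Finset.card (α := ℕ))).tsum_eq, ENNReal.tsum_sigma']
  refine tsum_congr fun d => ?_
  rw [← (strictAntiEquivFinset d).tsum_eq]
  refine tsum_congr fun f => ?_
  exact Finset.prod_image f.2.injective.injOn

theorem ENNReal.prod_tsum_fin {d : ℕ} (g : Fin d → ℕ → ℝ≥0∞) :
    ∏ i, ∑' m, g i m = ∑' j : Fin d → ℕ, ∏ i, g i (j i) := by
  induction d with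
  | zero => simp [tsum_fintype]
  | succ d ih =>
    rw [Fin.prod_univ_succ, ih, ← (Fin.consEquiv fun _ => ℕ).tsum_eq, ENNReal.tsum_prod',
      ← ENNReal.tsum_mul_right]
    refine tsum_congr fun m => ?_
    rw [← ENNReal.tsum_mul_left]
    refine tsum_congr fun j => ?_
    simp [Fin.prod_univ_succ, Fin.consEquiv]

theorem ENNReal.tsum_tuple_eq_tsum_antidiagonalTuple {d : ℕ} (g : (Fin d → ℕ) → ℝ≥0∞) :
    ∑' j, g j = ∑' n, ∑ j ∈ Finset.Nat.antidiagonalTuple d n, g j := by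
  rw [← (Finset.Nat.sigmaAntidiagonalTupleEquivTuple d).tsum_eq, ENNReal.tsum_sigma']
  exact tsum_congr fun n => Finset.tsum_subtype _ g

/-- The extended nonnegative counterpart of `Tsum`, with the weights `w k` in place of
`1 / (2 k + 1) ^ 2`. -/
noncomputable def eTsum (w : ℕ → ℝ≥0∞) (n d : ℕ) : ℝ≥0∞ :=
  ∑ j ∈ (Finset.Nat.antidiagonalTuple d n).filter (fun j => ∀ i, 1 ≤ j i),
    ∑' f : {f : Fin d → ℕ // StrictAnti f}, ∏ i, w (f.1 i) ^ j i

theorem tsum_finset_prod_eq_tsum_eTsum (w : ℕ → ℝ≥0∞) (z : ℝ≥0∞) :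
    ∑' s : Finset ℕ, ∏ k ∈ s, ∑' m : ℕ, (if 1 ≤ m then (z * w k) ^ m else 0) =
      ∑' n, ∑' d, eTsum w n d * z ^ n := by
  rw [tsum_finset_prod_eq_tsum_strictAnti, ENNReal.tsum_comm]
  refine tsum_congr fun d => ?_
  simp_rw [ENNReal.prod_tsum_fin, Fintype.prod_ite_zero]
  rw [ENNReal.tsum_comm, ENNReal.tsum_tuple_eq_tsum_antidiagonalTuple]
  refine tsum_congr fun n => ?_
  rw [eTsum, Finset.sum_filter, Finset.sum_mul]
  refine Finset.sum_congr rfl fun j hj => ?_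
  split_ifs
  · rw [← ENNReal.tsum_mul_right]
    refine tsum_congr fun f => ?_
    simp_rw [mul_pow]
    rw [Finset.prod_mul_distrib, Finset.prod_pow_eq_pow_sum,
      Finset.Nat.mem_antidiagonalTuple.mp hj, mul_comm]
  · simp

theorem tsum_eTsum_zero (w : ℕ → ℝ≥0∞) : ∑' d, eTsum w 0 d = 1 := by
  rw [tsum_eq_single 0]
  · have : Unique {f : Fin 0 → ℕ // StrictAnti f} :=
      uniqueOfSubsingleton ⟨Fin.elim0, fun i => i.elim0⟩
    simp [eTsum, tsum_fintype]
  · intro d hd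
    have : NeZero d := ⟨hd⟩
    refine Finset.sum_eq_zero fun j hj => ?_
    simp only [Finset.mem_filter, Finset.Nat.mem_antidiagonalTuple] at hj
    have := Finset.sum_eq_zero_iff.mp hj.1 0 (Finset.mem_univ _)
    have := hj.2 0
    omega

theorem tsum_eTsum_succ (w : ℕ → ℝ≥0∞) (n : ℕ) :
    ∑' d, eTsum w (n + 1) d = ∑ d ∈ Finset.Icc 1 (n + 1), eTsum w (n + 1) d := by
  refine tsum_eq_sum fun d hd => Finset.sum_eq_zero fun j hj => absurd hd ?_
  simp only [Finset.mem_filter, Finset.Nat.mem_antidiagonalTuple] at hj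
  have hle : d ≤ n + 1 := by
    rw [← hj.1]
    simpa using Finset.sum_le_sum fun i (_ : i ∈ Finset.univ) => hj.2 i
  have hne : d ≠ 0 := by
    rintro rfl
    simp at hj
  simp only [Finset.mem_Icc, not_not]
  omega

theorem toReal_tsum_prod_eq_mtv {d : ℕ} (j : Fin d → ℕ) :
    (∑' f : {f : Fin d → ℕ // StrictAnti f},
      ∏ i, ENNReal.ofReal (1 / (2 * (f.1 i : ℝ) + 1) ^ 2) ^ j i).toReal =
      mtv d fun i => 2 * j i := by
  rw [ENNReal.tsum_toReal_eq
    fun f => ENNReal.prod_ne_top fun i _ => ENNReal.pow_ne_top ENNReal.ofReal_ne_top, mtv]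
  refine tsum_congr fun f => ?_
  rw [ENNReal.toReal_prod]
  refine Finset.prod_congr rfl fun i _ => ?_
  rw [ENNReal.toReal_pow, ENNReal.toReal_ofReal (by positivity), pow_mul, div_pow, one_pow]

theorem toReal_eTsum {n d : ℕ}
    (h : eTsum (fun k => ENNReal.ofReal (1 / (2 * (k : ℝ) + 1) ^ 2)) n d ≠ ∞) :
    (eTsum (fun k => ENNReal.ofReal (1 / (2 * (k : ℝ) + 1) ^ 2)) n d).toReal = Tsum n d := by
  rw [eTsum] at h ⊢
  rw [ENNReal.toReal_sum fun j hj => ENNReal.sum_ne_top.mp h j hj, Tsum]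
  exact Finset.sum_congr rfl fun j _ => toReal_tsum_prod_eq_mtv j

theorem tsum_eTsum_eq_ofReal_sec {u : ℝ} (hu0 : 0 < u) (hu1 : u < 1) :
    ∑' n, ∑' d, eTsum (fun k => ENNReal.ofReal (1 / (2 * (k : ℝ) + 1) ^ 2)) n d *
        ENNReal.ofReal u ^ n =
      ENNReal.ofReal (1 / Real.cos (Real.pi * √u / 2)) := by
  have hsec := hasSum_finset_prod_sec hu0 hu1
  have hlt (k : ℕ) : u / (2 * (k : ℝ) + 1) ^ 2 < 1 :=
    (div_le_self hu0.le (one_le_pow₀ (by linarith [k.cast_nonneg (α := ℝ)]))).trans_lt hu1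
  have hnonneg (k : ℕ) : 0 ≤ u / (2 * (k : ℝ) + 1) ^ 2 / (1 - u / (2 * (k : ℝ) + 1) ^ 2) :=
    div_nonneg (by positivity) (by linarith [hlt k])
  rw [← tsum_finset_prod_eq_tsum_eTsum, ← hsec.tsum_eq,
    ENNReal.ofReal_tsum_of_nonneg (fun s => Finset.prod_nonneg fun k _ => hnonneg k) hsec.summable]
  refine tsum_congr fun s => ?_
  rw [ENNReal.ofReal_prod_of_nonneg fun k _ => hnonneg k]
  refine Finset.prod_congr rfl fun k _ => ?_
  have hpos : 0 < 1 - u / (2 * (k : ℝ) + 1) ^ 2 := by linarith [hlt k]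
  rw [← ENNReal.ofReal_mul hu0.le, mul_one_div, tsum_eq_zero_add' ENNReal.summable]
  simp only [Nat.le_add_left, if_true, nonpos_iff_eq_zero, one_ne_zero, if_false, zero_add]
  rw [ENNReal.tsum_geometric_add_one, ENNReal.ofReal_div_of_pos hpos,
    ENNReal.ofReal_sub _ (by positivity), ENNReal.ofReal_one, ENNReal.div_eq_inv_mul, mul_comm]

/-- Specialization `v = 1` of the generating function:
`1 + ∑_{n ≥ 1} (∑_{d=1}^{n} T(2n,d)) u^n = sec(π√u/2)`. -/
theorem generating_function_at_one (u : ℝ) (hu0 : 0 ≤ u) (hu1 : u < 1) :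
    1 + ∑' n : ℕ, (∑ d ∈ Finset.Icc 1 (n + 1), Tsum (n + 1) d) * u ^ (n + 1)
      = 1 / Real.cos (Real.pi * Real.sqrt u / 2) := by
  rcases hu0.eq_or_lt with rfl | hu0
  · simp
  have htotal := tsum_eTsum_eq_ofReal_sec hu0 hu1
  set w : ℕ → ℝ≥0∞ := fun k => ENNReal.ofReal (1 / (2 * (k : ℝ) + 1) ^ 2)
  have hterm (n d : ℕ) : eTsum w n d ≠ ∞ := by
    have hle : eTsum w n d * ENNReal.ofReal u ^ n ≠ ∞ :=
      ENNReal.ne_top_of_tsum_ne_top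
        (ENNReal.ne_top_of_tsum_ne_top (htotal ▸ ENNReal.ofReal_ne_top) n) d
    intro h
    rw [h, ENNReal.top_mul (pow_ne_zero _ (by simpa using hu0))] at hle
    exact hle rfl
  simp_rw [ENNReal.tsum_mul_right] at htotal
  rw [tsum_eq_zero_add' ENNReal.summable, tsum_eTsum_zero, pow_zero, one_mul] at htotal
  simp_rw [tsum_eTsum_succ] at htotal
  have hcoeff (n : ℕ) : ∑ d ∈ Finset.Icc 1 (n + 1), eTsum w (n + 1) d ≠ ∞ :=
    ENNReal.sum_ne_top.mpr fun d _ => hterm _ d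
  have hfin : ∑' n : ℕ, (∑ d ∈ Finset.Icc 1 (n + 1), eTsum w (n + 1) d) *
      ENNReal.ofReal u ^ (n + 1) ≠ ∞ := by
    intro h
    simp [h] at htotal
  have hreal := congrArg ENNReal.toReal htotal
  rw [ENNReal.toReal_add ENNReal.one_ne_top hfin, ENNReal.toReal_one, ENNReal.tsum_toReal_eq
    fun n => ENNReal.mul_ne_top (hcoeff n) (ENNReal.pow_ne_top ENNReal.ofReal_ne_top),
    ENNReal.toReal_ofReal] at hreal
  · rw [← hreal]
    congr 1
    refine tsum_congr fun n => ?_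
    rw [ENNReal.toReal_mul, ENNReal.toReal_pow, ENNReal.toReal_ofReal hu0.le,
      ENNReal.toReal_sum fun d _ => hterm _ d]
    congr 1
    exact Finset.sum_congr rfl fun d _ => (toReal_eTsum (hterm _ d)).symm
  · refine (hasSum_finset_prod_sec hu0 hu1).nonneg fun s => Finset.prod_nonneg fun k _ => ?_
    have : u / (2 * (k : ℝ) + 1) ^ 2 ≤ u :=
      div_le_self hu0.le (one_le_pow₀ (by linarith [k.cast_nonneg (α := ℝ)]))
    exact div_nonneg (by positivity) (by linarith)
end
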